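/- arXiv:1708.02855 — 2 statements merged into one kernel-verified Lean document; each statement's English description precedes it below -/
import Mathlib

section
/- Let X and Y be two generalized Peano continua, and assume that G is a finitely generated group acting properly and cocompactly by homeomorphisms on both X and Y. If X is one-ended — that is, X is not compact and for every compact K ⊆ X there is a compact K′ ⊇ K such that any two points of X ∖ K′ lie in the same connected component of X ∖ K — then Y is one-ended. -/
open Set Pointwise

/-- A generalized Peano continuum: a connected, locally compact, locally connected,
σ-compact, metrizable topological space. -/
structure IsGenPeanoContinuum (X : Type*) [TopologicalSpace X] : Prop where
  connectedSpace : ConnectedSpace X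
  locallyCompactSpace : LocallyCompactSpace X
  locallyConnectedSpace : LocallyConnectedSpace X
  sigmaCompactSpace : SigmaCompactSpace X
  metrizableSpace : TopologicalSpace.MetrizableSpace X

/-- An exhaustion of a space by compact sets. -/
structure IsExhaustion {X : Type*} [TopologicalSpace X] (C : ℕ → Set X) : Prop where
  isCompact : ∀ i, IsCompact (C i)
  subset_interior : ∀ i, C i ⊆ interior (C (i + 1))
  iUnion_eq : (⋃ i, C i) = Set.univ

/-- The space of ends of `X` with respect to the exhaustion `C`: the inverse limit of the
sets of connected components of the complements `X ∖ C i`, the bonding maps being induced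
by inclusion. -/
def EndsSpace {X : Type*} [TopologicalSpace X] (C : ℕ → Set X) : Type _ :=
  { E : ℕ → Set X //
      (∀ i, ∃ x ∈ (C i)ᶜ, E i = connectedComponentIn (C i)ᶜ x) ∧
        ∀ i, E (i + 1) ⊆ E i }

/-- `EndsSpace C` is topologized as a subspace of the product of the discrete spaces of
components. -/
instance EndsSpace.instTopologicalSpace {X : Type*} [TopologicalSpace X] (C : ℕ → Set X) :
    TopologicalSpace (EndsSpace C) :=
  TopologicalSpace.induced (fun E => (E.1 : ℕ → Set X))
    (@Pi.topologicalSpace ℕ (fun _ => Set X) fun _ => ⊥)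

/-- `G` acts on `X` by homeomorphisms. -/
def ContinuousActionOn (G X : Type*) [Group G] [TopologicalSpace X] [MulAction G X] : Prop :=
  ∀ g : G, Continuous fun x : X => g • x

/-- The action of `G` on `X` is proper: for every compact `K`, only finitely many translates
of `K` meet `K`. -/
def ProperActionOn (G X : Type*) [Group G] [TopologicalSpace X] [MulAction G X] : Prop :=
  ∀ K : Set X, IsCompact K → {g : G | ((g • K) ∩ K).Nonempty}.Finite

/-- The action of `G` on `X` is cocompact: the translates of some compact set cover `X`. -/
def CocompactActionOn (G X : Type*) [Group G] [TopologicalSpace X] [MulAction G X] : Prop :=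
  ∃ K : Set X, IsCompact K ∧ (⋃ g : G, g • K) = Set.univ

/-- A noncompact space is one-ended: for every compact `K` there is a larger compact `K'`
such that any two points outside `K'` lie in the same connected component of the complement
of `K`. -/
def IsOneEnded (X : Type*) [TopologicalSpace X] : Prop :=
  ¬ CompactSpace X ∧
    ∀ K : Set X, IsCompact K → ∃ K' : Set X, IsCompact K' ∧ K ⊆ K' ∧
      ∀ x ∉ K', ∀ y ∉ K', y ∈ connectedComponentIn Kᶜ x

/-- In a connected, locally connected, locally compact Hausdorff space, every compact set is
contained in a compact connected set through a prescribed point. -/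
theorem IsCompact.exists_isPreconnected_superset {Y : Type*} [TopologicalSpace Y] [T2Space Y]
    [LocallyCompactSpace Y] [LocallyConnectedSpace Y] [PreconnectedSpace Y]
    {K : Set Y} (hK : IsCompact K) (b : Y) :
    ∃ C, IsCompact C ∧ IsPreconnected C ∧ b ∈ C ∧ K ⊆ C := by
  have hloc : ∀ x : Y, ∃ C ∈ nhds x, IsCompact C ∧ IsPreconnected C := fun x => by
    obtain ⟨N, hN, hxN⟩ := exists_compact_mem_nhds x
    obtain ⟨V, hV, hVc, hVN⟩ :=
      locallyConnectedSpace_iff_connected_subsets.1 inferInstance x N hxN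
    exact ⟨closure V, Filter.mem_of_superset hV subset_closure,
      hN.closure_of_subset hVN, hVc.closure⟩
  have hjoin : ∀ x y : Y, ∃ C, IsCompact C ∧ IsPreconnected C ∧ x ∈ C ∧ y ∈ C := fun x y => by
    refine isPreconnected_univ.induction₂
      (fun x y => ∃ C : Set Y, IsCompact C ∧ IsPreconnected C ∧ x ∈ C ∧ y ∈ C)
      (fun x _ => ?_) ?_ ?_ (mem_univ x) (mem_univ y)
    · obtain ⟨C, hCx, hC, hCp⟩ := hloc x
      filter_upwards [mem_nhdsWithin_of_mem_nhds hCx] with z hz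
      exact ⟨C, hC, hCp, mem_of_mem_nhds hCx, hz⟩
    · rintro x y z - - - ⟨C, hC, hCp, hxC, hyC⟩ ⟨D, hD, hDp, hyD, hzD⟩
      exact ⟨C ∪ D, hC.union hD, hCp.union y hyC hyD hDp, Or.inl hxC, Or.inr hzD⟩
    · rintro x y - - ⟨C, hC, hCp, hxC, hyC⟩
      exact ⟨C, hC, hCp, hyC, hxC⟩
  refine hK.induction_on ?_ ?_ ?_ fun x _ => ?_
  · exact ⟨{b}, isCompact_singleton, isPreconnected_singleton, rfl, empty_subset _⟩
  · rintro s t hst ⟨C, hC, hCp, hbC, htC⟩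
    exact ⟨C, hC, hCp, hbC, hst.trans htC⟩
  · rintro s t ⟨C, hC, hCp, hbC, hsC⟩ ⟨D, hD, hDp, hbD, htD⟩
    exact ⟨C ∪ D, hC.union hD, hCp.union b hbC hbD hDp, Or.inl hbC, union_subset_union hsC htD⟩
  · obtain ⟨C, hCx, hC, hCp⟩ := hloc x
    obtain ⟨D, hD, hDp, hbD, hxD⟩ := hjoin b x
    exact ⟨C, mem_nhdsWithin_of_mem_nhds hCx, D ∪ C, hD.union hC,
      hDp.union x hxD (mem_of_mem_nhds hCx) hCp, Or.inl hbD, subset_union_right⟩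

theorem ProperActionOn.finite_inter_nonempty {G X : Type*} [Group G] [TopologicalSpace X]
    [MulAction G X] (h : ProperActionOn G X) {K L : Set X} (hK : IsCompact K)
    (hL : IsCompact L) : {g : G | ((g • K) ∩ L).Nonempty}.Finite :=
  (h (K ∪ L) (hK.union hL)).subset fun _ hg => hg.mono
    (inter_subset_inter (smul_set_mono subset_union_left) subset_union_right)

/-- If a finitely generated group `G` acts properly and cocompactly by
homeomorphisms on two generalized Peano continua `X` and `Y`, and `X` is one-ended, then
`Y` is one-ended. -/
theorem oneEnded_of_oneEnded_of_proper_cocompact_actions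
    {G X Y : Type*} [Group G] [TopologicalSpace X] [TopologicalSpace Y]
    [MulAction G X] [MulAction G Y]
    (hG : Group.FG G)
    (hX : IsGenPeanoContinuum X) (hY : IsGenPeanoContinuum Y)
    (hXcont : ContinuousActionOn G X) (hYcont : ContinuousActionOn G Y)
    (hXproper : ProperActionOn G X) (hYproper : ProperActionOn G Y)
    (hXcocompact : CocompactActionOn G X) (hYcocompact : CocompactActionOn G Y)
    (hone : IsOneEnded X) :
    IsOneEnded Y := by
  have := hX.connectedSpace
  have := hX.locallyCompactSpace
  have := hY.connectedSpace
  have := hY.locallyCompactSpace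
  have := hY.locallyConnectedSpace
  have := hY.metrizableSpace
  have : ContinuousConstSMul G X := ⟨hXcont⟩
  have : ContinuousConstSMul G Y := ⟨hYcont⟩
  obtain ⟨A₀, hA₀, hA₀cov⟩ := hXcocompact
  obtain ⟨B₀, hB₀, hB₀cov⟩ := hYcocompact
  obtain ⟨A, hA, hA₀A⟩ := exists_compact_superset hA₀
  have hAcov : ∀ x : X, ∃ g : G, x ∈ interior (g • A) := fun x => by
    obtain ⟨g, hg⟩ := mem_iUnion.1 (hA₀cov.symm ▸ mem_univ x)
    exact ⟨g, by rw [interior_smul]; exact smul_set_mono hA₀A hg⟩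
  obtain ⟨b⟩ : Nonempty Y := inferInstance
  have hT := hXproper A hA
  obtain ⟨B, hB, hBp, hbB, hsubB⟩ :=
    (hB₀.union (hT.image fun g : G => g • b).isCompact).exists_isPreconnected_superset b
  have hBcov : ∀ y : Y, ∃ g : G, y ∈ g • B := fun y => by
    obtain ⟨g, hg⟩ := mem_iUnion.1 (hB₀cov.symm ▸ mem_univ y)
    exact ⟨g, smul_set_mono (subset_union_left.trans hsubB) hg⟩
  have hBpre : ∀ g : G, IsPreconnected (g • B) := fun g =>
    hBp.image _ (continuous_const_smul g).continuousOn
  have hAB : ∀ g h : G, ((g • A) ∩ (h • A)).Nonempty → ((g • B) ∩ (h • B)).Nonempty := by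
    rintro g h ⟨x, hxg, hxh⟩
    refine ⟨g • b, smul_mem_smul_set hbB, ?_⟩
    rw [mem_smul_set_iff_inv_smul_mem] at hxg hxh ⊢
    refine hsubB (Or.inr ⟨h⁻¹ * g, ⟨h⁻¹ • x, ?_, hxh⟩, mul_smul _ _ _⟩)
    exact ⟨g⁻¹ • x, hxg, by simp [mul_smul]⟩
  refine ⟨fun hYc => hone.1 ?_, fun K hK => ?_⟩
  · have hfin : (univ : Set G).Finite := (hYproper univ isCompact_univ).subset fun g _ =>
      ⟨g • b, smul_mem_smul_set (mem_univ b), mem_univ _⟩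
    have : Finite G := finite_univ_iff.1 hfin
    exact ⟨hA₀cov ▸ isCompact_iUnion fun g => hA₀.smul g⟩
  have hF := hYproper.finite_inter_nonempty hB hK
  set F : Set G := {g : G | ((g • B) ∩ K).Nonempty} with hFdef
  have hKX : IsCompact (⋃ g ∈ F, g • A) := hF.isCompact_biUnion fun g _ => hA.smul g
  set L : Set X := ⋃ g ∈ F, g • A with hLdef
  obtain ⟨L', hL', -, hLL'⟩ := hone.2 L hKX
  have hF' := hXproper.finite_inter_nonempty hA hL'
  set F' : Set G := {g : G | ((g • A) ∩ L').Nonempty} with hF'def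
  have hBK : ∀ {x : X} {g : G}, x ∈ Lᶜ → x ∈ g • A → g • B ⊆ Kᶜ := fun {x g} hx hxg y hy hyK =>
    hx (mem_biUnion (show g ∈ F from ⟨y, hy, hyK⟩) hxg)
  -- Chains of translates of `A` in `X ∖ L` correspond to chains of translates of `B` in `Y ∖ K`.
  let P : X → X → Prop := fun x y => ∀ g h : G, x ∈ g • A → y ∈ h • A →
    ∀ u ∈ g • B, ∀ v ∈ h • B, v ∈ connectedComponentIn Kᶜ u
  have hP : ∀ x ∉ L', ∀ y ∉ L', P x y := fun x hx y hy => by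
    have hy' := hLL' x hx y hy
    have hsub := connectedComponentIn_subset Lᶜ x
    have hx' : x ∈ connectedComponentIn Lᶜ x := mem_connectedComponentIn
      (by by_contra h; simp [connectedComponentIn_eq_empty h] at hy')
    refine isPreconnected_connectedComponentIn.induction₂ P (fun z hz => ?_) ?_ ?_ hx' hy'
    · obtain ⟨k, hk⟩ := hAcov z
      filter_upwards [mem_nhdsWithin_of_mem_nhds (isOpen_interior.mem_nhds hk),
        self_mem_nhdsWithin] with w hw hwC g h hzg hwh u hu v hv
      have hgk := hAB g k ⟨z, hzg, interior_subset hk⟩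
      have hkh := hAB k h ⟨w, interior_subset hw, hwh⟩
      have hcon : IsPreconnected (g • B ∪ k • B ∪ h • B) :=
        ((hBpre g).union' hgk (hBpre k)).union'
          (hkh.mono (inter_subset_inter_left _ subset_union_right)) (hBpre h)
      exact hcon.subset_connectedComponentIn (Or.inl (Or.inl hu))
        (union_subset (union_subset (hBK (hsub hz) hzg)
          (hBK (hsub hz) (interior_subset hk))) (hBK (hsub hwC) hwh)) (Or.inr hv)
    · intro p q r _ _ _ hpq hqr g h hg hh u hu v hv
      obtain ⟨k, hk⟩ := hAcov q
      have hkq := interior_subset hk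
      have hw : k • b ∈ k • B := smul_mem_smul_set hbB
      rw [connectedComponentIn_eq (hpq g k hg hkq u hu _ hw)]
      exact hqr k h hkq hh _ hw v hv
    · intro p q hp _ hpq g h hg hh u hu v hv
      have huv := hpq h g hh hg v hv u hu
      rw [← connectedComponentIn_eq huv]
      exact mem_connectedComponentIn (hBK (hsub hp) hh hv)
  refine ⟨K ∪ ⋃ g ∈ F', g • B, hK.union (hF'.isCompact_biUnion fun g _ => hB.smul g),
    subset_union_left, fun x hx y hy => ?_⟩
  obtain ⟨g, hg⟩ := hBcov x
  obtain ⟨h, hh⟩ := hBcov y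
  obtain ⟨x₀⟩ : Nonempty X := inferInstance
  obtain ⟨k, hk⟩ := hAcov x₀
  obtain ⟨a, ha, -⟩ := interior_subset hk
  have hout : ∀ {g : G} {y : Y}, y ∉ K ∪ ⋃ g ∈ F', g • B → y ∈ g • B → g • a ∉ L' :=
    fun {g y} hy hyg hga => hy (Or.inr (mem_biUnion
      (show g ∈ F' from ⟨g • a, smul_mem_smul_set ha, hga⟩) hyg))
  exact hP _ (hout hx hg) _ (hout hy hh) g h (smul_mem_smul_set ha) (smul_mem_smul_set ha)
    x hg y hh
end

section
/- Let X be a generalized Peano continuum, let 𝒟 be a monotone upper semi-continuous decomposition of X, and let f : X → X/𝒟 be the decomposition map. Then f induces a homeomorphism between Ends(X) and Ends(X/𝒟). -/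
open Set Pointwise

/-- A decomposition (partition) of `X` is encoded by a setoid `s`; the elements of the
decomposition are the equivalence classes `{y | s.r x y}`.  The saturation of a set `A` is
the union of `A` with all decomposition elements meeting `A`. -/
def decompSat {X : Type*} (s : Setoid X) (A : Set X) : Set X :=
  {x : X | ∃ a ∈ A, s.r x a}

/-- The decomposition `s` of `X` is upper semi-continuous: every decomposition element is
closed and compact, and every open set `U` containing a decomposition element `D` contains
an open set `V` with `D ⊆ V ⊆ U` whose saturation lies in `U`. -/
structure IsUSCDecomposition {X : Type*} [TopologicalSpace X] (s : Setoid X) : Prop where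
  isClosed : ∀ x : X, IsClosed {y | s.r x y}
  isCompact : ∀ x : X, IsCompact {y | s.r x y}
  shrink : ∀ (x : X) (U : Set X), IsOpen U → {y | s.r x y} ⊆ U →
    ∃ V : Set X, IsOpen V ∧ {y | s.r x y} ⊆ V ∧ V ⊆ U ∧ decompSat s V ⊆ U

/-- The decomposition `s` is monotone: it is upper semi-continuous and each decomposition
element is connected. -/
def IsMonotoneUSCDecomposition {X : Type*} [TopologicalSpace X] (s : Setoid X) : Prop :=
  IsUSCDecomposition s ∧ ∀ x : X, IsConnected {y | s.r x y}

theorem IsExhaustion.monotone {X : Type*} [TopologicalSpace X] {C : ℕ → Set X}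
    (hC : IsExhaustion C) : Monotone C :=
  monotone_nat_of_le_succ fun i => (hC.subset_interior i).trans interior_subset

/-- Every compact set is contained in some member of an exhaustion. -/
theorem IsExhaustion.exists_subset {X : Type*} [TopologicalSpace X] {C : ℕ → Set X}
    (hC : IsExhaustion C) {K : Set X} (hK : IsCompact K) : ∃ i, K ⊆ C i := by
  obtain ⟨i, hi⟩ := hK.elim_directed_cover (fun i => interior (C i))
    (fun _ => isOpen_interior)
    (fun x _ => by
      obtain ⟨i, hi⟩ := mem_iUnion.1 (hC.iUnion_eq ▸ mem_univ x : x ∈ ⋃ i, C i)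
      exact mem_iUnion.2 ⟨i + 1, hC.subset_interior i hi⟩)
    (Monotone.directed_le fun _ _ h => interior_mono (hC.monotone h))
  exact ⟨i, hi.trans interior_subset⟩

/-- The preimage of a preconnected set under a closed surjection with preconnected fibers is
preconnected. -/
theorem IsPreconnected.preimage_of_isClosedMap_of_fibers {X Y : Type*} [TopologicalSpace X]
    [TopologicalSpace Y] {f : X → Y} (hf : IsClosedMap f) (hsurj : Function.Surjective f)
    (hfib : ∀ y, IsPreconnected (f ⁻¹' {y})) {S : Set Y} (hS : IsPreconnected S) :
    IsPreconnected (f ⁻¹' S) := by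
  refine isPreconnected_closed_iff.2 fun u v hu hv huv hSu hSv => ?_
  obtain ⟨y, hyS, ⟨a, hau, rfl⟩, b, hbv, hab⟩ : (S ∩ (f '' u ∩ f '' v)).Nonempty := by
    refine isPreconnected_closed_iff.1 hS _ _ (hf u hu) (hf v hv) ?_ ?_ ?_
    · rw [← image_preimage_eq S hsurj, ← image_union]
      exact image_mono huv
    · obtain ⟨x, hxS, hxu⟩ := hSu
      exact ⟨f x, hxS, mem_image_of_mem f hxu⟩
    · obtain ⟨x, hxS, hxv⟩ := hSv
      exact ⟨f x, hxS, mem_image_of_mem f hxv⟩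
  have hsub : f ⁻¹' {f a} ⊆ f ⁻¹' S := preimage_mono (singleton_subset_iff.2 hyS)
  exact (isPreconnected_closed_iff.1 (hfib (f a)) u v hu hv (hsub.trans huv)
    ⟨a, rfl, hau⟩ ⟨b, hab, hbv⟩).mono (inter_subset_inter_left _ hsub)

namespace EndsSpace

variable {X Y : Type*} [TopologicalSpace X] [TopologicalSpace Y] {C : ℕ → Set X}
  {D : ℕ → Set Y}

theorem antitone (E : EndsSpace C) : Antitone E.1 :=
  antitone_nat_of_succ_le E.2.2

theorem nonempty (E : EndsSpace C) (i : ℕ) : (E.1 i).Nonempty := by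
  obtain ⟨x, hx, h⟩ := E.2.1 i
  exact h ▸ ⟨x, mem_connectedComponentIn hx⟩

theorem isPreconnected (E : EndsSpace C) (i : ℕ) : IsPreconnected (E.1 i) := by
  obtain ⟨x, -, h⟩ := E.2.1 i
  exact h ▸ isPreconnected_connectedComponentIn

theorem subset_compl (E : EndsSpace C) (i : ℕ) : E.1 i ⊆ (C i)ᶜ := by
  obtain ⟨x, -, h⟩ := E.2.1 i
  exact h ▸ connectedComponentIn_subset _ _

theorem eq_connectedComponentIn (E : EndsSpace C) {i : ℕ} {x : X} (hx : x ∈ E.1 i) :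
    E.1 i = connectedComponentIn (C i)ᶜ x := by
  obtain ⟨y, -, h⟩ := E.2.1 i
  rw [h] at hx ⊢
  exact connectedComponentIn_eq hx

theorem eq_of_subset {E E' : EndsSpace C} {i : ℕ} {S : Set X} (hS : S.Nonempty)
    (h : S ⊆ E.1 i) (h' : S ⊆ E'.1 i) : E.1 i = E'.1 i := by
  obtain ⟨x, hx⟩ := hS
  rw [E.eq_connectedComponentIn (h hx), E'.eq_connectedComponentIn (h' hx)]

theorem isOpen_setOf_eq (E : EndsSpace C) (i : ℕ) :
    IsOpen {E' : EndsSpace C | E'.1 i = E.1 i} := by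
  let _ : TopologicalSpace (Set X) := ⊥
  have : DiscreteTopology (Set X) := ⟨rfl⟩
  have hcont : Continuous fun E' : EndsSpace C => E'.1 i :=
    (continuous_apply i).comp continuous_induced_dom
  exact (isOpen_discrete {E.1 i}).preimage hcont

theorem continuous_of_locally_eq {h : EndsSpace C → EndsSpace D}
    (hh : ∀ j, ∃ i, ∀ E E' : EndsSpace C, E'.1 i = E.1 i → (h E').1 j = (h E).1 j) :
    Continuous h := by
  let _ : TopologicalSpace (Set Y) := ⊥
  refine continuous_induced_rng.2 (continuous_pi fun j => ?_)
  obtain ⟨i, hi⟩ := hh j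
  refine IsLocallyConstant.continuous (IsLocallyConstant.iff_exists_open _ |>.2 fun E => ?_)
  exact ⟨_, E.isOpen_setOf_eq i, rfl, fun E' hE' => hi E E' hE'⟩

/-- A monotone operation on sets that preserves connectedness and moves complements of the
members of `C` into complements of the members of `D` induces a continuous map on ends. -/
theorem exists_continuous_map (hD : Monotone D) (Φ : Set X → Set Y) (hΦ : Monotone Φ)
    (hne : ∀ S, S.Nonempty → (Φ S).Nonempty)
    (hconn : ∀ S, IsPreconnected S → IsPreconnected (Φ S))
    (hCD : ∀ j, ∃ i, Φ (C i)ᶜ ⊆ (D j)ᶜ) :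
    ∃ h : EndsSpace C → EndsSpace D, Continuous h ∧
      ∀ E j i, Φ (C i)ᶜ ⊆ (D j)ᶜ → Φ (E.1 i) ⊆ (h E).1 j := by
  choose k hk using hCD
  choose p hp using fun (E : EndsSpace C) j => hne _ (E.nonempty (k j))
  have hcomp : ∀ (E : EndsSpace C) j i, Φ (C i)ᶜ ⊆ (D j)ᶜ →
      Φ (E.1 i) ⊆ connectedComponentIn (D j)ᶜ (p E j) := by
    intro E j i hij
    have hsub : ∀ l, Φ (C l)ᶜ ⊆ (D j)ᶜ → Φ (E.1 l) ⊆ (D j)ᶜ :=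
      fun l hl => (hΦ (E.subset_compl l)).trans hl
    obtain ⟨y, hy⟩ := hne _ (E.nonempty (max i (k j)))
    have hyi : y ∈ Φ (E.1 i) := hΦ (E.antitone (le_max_left _ _)) hy
    have hyk : y ∈ Φ (E.1 (k j)) := hΦ (E.antitone (le_max_right _ _)) hy
    rw [connectedComponentIn_eq ((hconn _ (E.isPreconnected _)).subset_connectedComponentIn
      (hp E j) (hsub _ (hk j)) hyk)]
    exact (hconn _ (E.isPreconnected _)).subset_connectedComponentIn hyi (hsub i hij)
  have hmem : ∀ E j, p E j ∈ (D j)ᶜ :=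
    fun E j => (hΦ (E.subset_compl _)).trans (hk j) (hp E j)
  let h : EndsSpace C → EndsSpace D := fun E =>
    ⟨fun j => connectedComponentIn (D j)ᶜ (p E j), fun j => ⟨p E j, hmem E j, rfl⟩, fun j => by
      have hDj : (D (j + 1))ᶜ ⊆ (D j)ᶜ := compl_subset_compl.2 (hD j.le_succ)
      have hq : p E (j + 1) ∈ connectedComponentIn (D j)ᶜ (p E j) :=
        hcomp E j (k (j + 1)) ((hk (j + 1)).trans hDj) (hp E (j + 1))
      change connectedComponentIn _ _ ⊆ connectedComponentIn _ _
      rw [connectedComponentIn_eq hq]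
      exact connectedComponentIn_mono _ hDj⟩
  refine ⟨h, continuous_of_locally_eq fun j => ⟨k j, fun E E' hEE' => ?_⟩, hcomp⟩
  refine eq_of_subset (hne _ (E.nonempty (k j))) ?_ (hcomp E j _ (hk j))
  rw [← hEE']
  exact hcomp E' j _ (hk j)

end EndsSpace

/-- The decomposition map of an upper semi-continuous decomposition is closed. -/
theorem IsUSCDecomposition.isClosedMap {X : Type*} [TopologicalSpace X] {s : Setoid X}
    (hs : IsUSCDecomposition s) : IsClosedMap (Quotient.mk s) := by
  intro A hA
  rw [← isQuotientMap_quotient_mk'.isClosed_preimage, ← isOpen_compl_iff,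
    isOpen_iff_forall_mem_open]
  intro x hx
  obtain ⟨V, hV, hxV, -, hsat⟩ := hs.shrink x Aᶜ hA.isOpen_compl fun y hy hyA =>
    hx ⟨y, hyA, Quotient.sound (s.symm hy)⟩
  refine ⟨V, ?_, hV, hxV (s.refl x)⟩
  rintro z hz ⟨a, ha, haz⟩
  exact hsat ⟨z, hz, Quotient.exact haz⟩ ha

theorem preimage_quotient_mk_singleton {X : Type*} (s : Setoid X) (x : X) :
    Quotient.mk s ⁻¹' {Quotient.mk s x} = {y | s.r x y} := by
  ext y
  exact ⟨fun h => s.symm (Quotient.exact h), fun h => Quotient.sound (s.symm h)⟩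

/-- The decomposition map of an upper semi-continuous decomposition is proper. -/
theorem IsUSCDecomposition.isProperMap {X : Type*} [TopologicalSpace X] {s : Setoid X}
    (hs : IsUSCDecomposition s) : IsProperMap (Quotient.mk s) := by
  refine isProperMap_iff_isClosedMap_and_compact_fibers.2
    ⟨continuous_quotient_mk', hs.isClosedMap, fun y => ?_⟩
  induction y using Quotient.inductionOn with
  | h x => exact preimage_quotient_mk_singleton s x ▸ hs.isCompact x

/-- Let `𝒟` be a monotone upper semi-continuous decomposition of a
generalized Peano continuum `X`, with decomposition map `f : X → X/𝒟`.  Then `f` induces a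
homeomorphism of `Ends(X)` with `Ends(X/𝒟)`: for any exhaustions `C` of `X` and `D` of
`X/𝒟` there is a homeomorphism `h : Ends(X) ≃ₜ Ends(X/𝒟)` compatible with `f`, in the
sense that whenever `f⁻¹(D j) ⊆ C i`, the component `E i` of an end `E` is mapped by `f`
into the component `(h E) j`. -/
theorem ends_homeomorph_of_monotone_usc_decomposition
    {X : Type*} [TopologicalSpace X]
    (hX : IsGenPeanoContinuum X)
    (s : Setoid X) (hs : IsMonotoneUSCDecomposition s)
    (C : ℕ → Set X) (hC : IsExhaustion C)
    (D : ℕ → Set (Quotient s)) (hD : IsExhaustion D) :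
    ∃ h : EndsSpace C ≃ₜ EndsSpace D,
      ∀ (E : EndsSpace C) (j i : ℕ),
        Quotient.mk s ⁻¹' (D j) ⊆ C i →
          Quotient.mk s '' (E.1 i) ⊆ (h E).1 j := by
  set f := Quotient.mk s
  have hsurj : Function.Surjective f := Quotient.mk_surjective
  have hproper : IsProperMap f := hs.1.isProperMap
  have hfib : ∀ y, IsPreconnected (f ⁻¹' {y}) := fun y => by
    obtain ⟨x, rfl⟩ := hsurj y
    exact preimage_quotient_mk_singleton s x ▸ (hs.2 x).isPreconnected
  have himage : ∀ {i j}, f ⁻¹' D j ⊆ C i → f '' (C i)ᶜ ⊆ (D j)ᶜ := by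
    rintro i j hij _ ⟨x, hx, rfl⟩ hxD
    exact hx (hij hxD)
  have hpreimage : ∀ {i j}, f '' C i ⊆ D j → f ⁻¹' (D j)ᶜ ⊆ (C i)ᶜ :=
    fun hij x hx hxC => hx (hij (mem_image_of_mem f hxC))
  have hexC : ∀ j, ∃ i, f ⁻¹' D j ⊆ C i :=
    fun j => hC.exists_subset (hproper.isCompact_preimage (hD.isCompact j))
  have hexD : ∀ i, ∃ j, f '' C i ⊆ D j :=
    fun i => hD.exists_subset ((hC.isCompact i).image hproper.continuous)
  obtain ⟨g, hg, hgf⟩ := EndsSpace.exists_continuous_map (C := C) hD.monotone (image f)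
    (fun _ _ => image_mono) (fun _ hS => hS.image f)
    (fun _ hS => hS.image f hproper.continuous.continuousOn)
    (fun j => (hexC j).imp fun _ => himage)
  obtain ⟨g', hg', hgf'⟩ := EndsSpace.exists_continuous_map (C := D) hC.monotone (preimage f)
    (fun _ _ => preimage_mono) (fun _ hS => hS.preimage hsurj)
    (fun _ hS => hS.preimage_of_isClosedMap_of_fibers hproper.isClosedMap hsurj hfib)
    (fun i => (hexD i).imp fun _ => hpreimage)
  have hleft : Function.LeftInverse g' g := fun E => Subtype.ext <| funext fun i => by
    obtain ⟨j, hij⟩ := hexD i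
    obtain ⟨l, hl⟩ := hexC j
    have hsub : E.1 l ⊆ (g' (g E)).1 i :=
      (image_subset_iff.1 (hgf E j l (himage hl))).trans (hgf' (g E) i j (hpreimage hij))
    exact EndsSpace.eq_of_subset (E.nonempty (max i l))
      ((E.antitone (le_max_right _ _)).trans hsub) (E.antitone (le_max_left _ _))
  have hright : Function.RightInverse g' g := fun F => Subtype.ext <| funext fun j => by
    obtain ⟨i, hij⟩ := hexC j
    obtain ⟨l, hl⟩ := hexD i
    have hsub : F.1 l ⊆ (g (g' F)).1 j := by
      rw [← image_preimage_eq (F.1 l) hsurj]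
      exact (image_mono (hgf' F i l (hpreimage hl))).trans (hgf (g' F) j i (himage hij))
    exact EndsSpace.eq_of_subset (F.nonempty (max j l))
      ((F.antitone (le_max_right _ _)).trans hsub) (F.antitone (le_max_left _ _))
  exact ⟨⟨⟨g, g', hleft, hright⟩, hg, hg'⟩, fun E j i hij => hgf E j i (himage hij)⟩
end
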